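/- For any prime number p, the cardinality of 𝓑(p) satisfies |#𝓑(p) − p/16| ≤ 24 · p^{3/4} · log p, where log denotes the natural logarithm. -/

import Mathlib

/-- The inverse of `b` modulo `p`, normalized to lie in `[0, p-1]`. -/
def modInv (p b : ℕ) : ℕ := ((b : ZMod p)⁻¹).val

/-- The set `𝓑₋(p)` of integers `β` with `1 ≤ β ≤ (p-3)/2`, `p ≤ β + 2β̄ + 1` and `β > β̄`. -/
def Bminus (p : ℕ) : Finset ℕ :=
  (Finset.Icc 1 p).filter fun β =>
    2 * β + 3 ≤ p ∧ p ≤ β + 2 * modInv p β + 1 ∧ modInv p β < β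

/-- The set `𝓑₊(p)` of integers `β` with `1 ≤ β ≤ (p-3)/2`, `β + β̄ ≥ p` and `β̄ ≤ 2β`. -/
def Bplus (p : ℕ) : Finset ℕ :=
  (Finset.Icc 1 p).filter fun β =>
    2 * β + 3 ≤ p ∧ p ≤ β + modInv p β ∧ modInv p β ≤ 2 * β

/-- The set `𝓑(p) = 𝓑₋(p) ∪ 𝓑₊(p)`. -/
def Bset (p : ℕ) : Finset ℕ := Bminus p ∪ Bplus p

open Finset

/-- The Kloosterman sum `∑_{x ≠ 0} e((a x + b x⁻¹) / p)`. -/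
noncomputable def kloosterman (p : ℕ) [Fact p.Prime] (a b : ZMod p) : ℂ :=
  ∑ x ∈ univ.erase (0 : ZMod p), ZMod.stdAddChar (a * x + b * x⁻¹)

theorem sum_stdAddChar_mul (p : ℕ) [Fact p.Prime] (u : ZMod p) :
    ∑ a : ZMod p, ZMod.stdAddChar (a * u) = if u = 0 then (p : ℂ) else 0 := by
  have h := AddChar.sum_mulShift (R' := ℂ) u (ZMod.isPrimitive_stdAddChar p)
  simpa [ZMod.card] using h

theorem sum_normSq_eq_card (p : ℕ) [Fact p.Prime] {ι : Type*} [DecidableEq ι] (S : Finset ι)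
    (f g : ι → ZMod p) :
    ∑ a : ZMod p, ∑ b : ZMod p, ‖∑ i ∈ S, ZMod.stdAddChar (a * f i + b * g i)‖ ^ 2 =
      (p : ℝ) ^ 2 * #{q ∈ S ×ˢ S | f q.1 = f q.2 ∧ g q.1 = g q.2} := by
  have key : ∀ a b : ZMod p,
      ((‖∑ i ∈ S, ZMod.stdAddChar (a * f i + b * g i)‖ ^ 2 : ℝ) : ℂ) =
      ∑ q ∈ S ×ˢ S, ZMod.stdAddChar (a * (f q.1 - f q.2)) *
        ZMod.stdAddChar (b * (g q.1 - g q.2)) := by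
    intro a b
    rw [Complex.ofReal_pow, ← Complex.mul_conj', map_sum, sum_mul_sum, ← sum_product']
    refine sum_congr rfl fun q _ => ?_
    rw [← AddChar.map_neg_eq_conj, ← AddChar.map_add_eq_mul, ← AddChar.map_add_eq_mul]
    congr 1
    ring
  apply Complex.ofReal_injective
  rw [Complex.ofReal_sum]
  simp_rw [Complex.ofReal_sum, key]
  simp_rw [sum_comm (t := S ×ˢ S), ← mul_sum, ← sum_mul, sum_stdAddChar_mul]
  rw [card_filter]
  push_cast
  rw [mul_sum]
  refine sum_congr rfl fun q _ => ?_
  simp only [sub_eq_zero]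
  split_ifs <;> simp_all [sq]

theorem card_add_inv_add_le (p : ℕ) [Fact p.Prime] :
    #{q ∈ ((univ.erase (0 : ZMod p)) ×ˢ (univ.erase (0 : ZMod p))) ×ˢ
        ((univ.erase (0 : ZMod p)) ×ˢ (univ.erase (0 : ZMod p))) |
        q.1.1 + q.1.2 = q.2.1 + q.2.2 ∧ q.1.1⁻¹ + q.1.2⁻¹ = q.2.1⁻¹ + q.2.2⁻¹} ≤
      3 * (p - 1) ^ 2 := by
  set S := univ.erase (0 : ZMod p) with hS
  have hc : #(S ×ˢ S) = (p - 1) ^ 2 := by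
    simp [hS, card_product, card_erase_of_mem, ZMod.card, sq]
  have hsub : {q ∈ (S ×ˢ S) ×ˢ (S ×ˢ S) |
        q.1.1 + q.1.2 = q.2.1 + q.2.2 ∧ q.1.1⁻¹ + q.1.2⁻¹ = q.2.1⁻¹ + q.2.2⁻¹} ⊆
      (S ×ˢ S).image (fun r => ((r.1, r.2), (r.1, r.2))) ∪
      ((S ×ˢ S).image (fun r => ((r.1, r.2), (r.2, r.1))) ∪
      (S ×ˢ S).image (fun r => ((r.1, -r.1), (r.2, -r.2)))) := by
    rintro ⟨⟨x, y⟩, ⟨z, w⟩⟩ h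
    simp only [hS, mem_filter, mem_product, mem_erase, mem_univ, and_true] at h
    obtain ⟨⟨⟨hx, hy⟩, hz, hw⟩, h1, h2⟩ := h
    have hprod : (x + y) * (z * w - x * y) = 0 := by
      field_simp at h2
      linear_combination h2 - x * y * h1
    simp only [hS, mem_union, mem_image, mem_product, mem_erase, mem_univ, and_true, Prod.mk.injEq,
      Prod.exists]
    rcases mul_eq_zero.mp hprod with h0 | h0
    · refine Or.inr (Or.inr ⟨x, z, ⟨hx, hz⟩, ⟨rfl, ?_⟩, rfl, ?_⟩)
      · linear_combination -h0
      · linear_combination h1 - h0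
    · have : (x - z) * (x - w) = 0 := by linear_combination h0 + x * h1
      rcases mul_eq_zero.mp this with h3 | h3
      · exact Or.inl ⟨x, y, ⟨hx, hy⟩, ⟨rfl, rfl⟩, by linear_combination h3,
          by linear_combination h1 - h3⟩
      · exact Or.inr (Or.inl ⟨x, y, ⟨hx, hy⟩, ⟨rfl, rfl⟩, by linear_combination h1 - h3,
          by linear_combination h3⟩)
  have h1 := (card_le_card hsub).trans (card_union_le _ _)
  have h2 := card_union_le ((S ×ˢ S).image (fun r : ZMod p × ZMod p => ((r.1, r.2), (r.2, r.1))))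
    ((S ×ˢ S).image (fun r => ((r.1, -r.1), (r.2, -r.2))))
  have h3 := card_image_le (s := S ×ˢ S) (f := fun r : ZMod p × ZMod p => ((r.1, r.2), (r.1, r.2)))
  have h4 := card_image_le (s := S ×ˢ S) (f := fun r : ZMod p × ZMod p => ((r.1, r.2), (r.2, r.1)))
  have h5 := card_image_le (s := S ×ˢ S)
    (f := fun r : ZMod p × ZMod p => ((r.1, -r.1), (r.2, -r.2)))
  omega

theorem kloosterman_mul_inv (p : ℕ) [Fact p.Prime] (a b t : ZMod p) (ht : t ≠ 0) :
    kloosterman p (a * t) (b * t⁻¹) = kloosterman p a b := by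
  unfold kloosterman
  refine sum_bij' (fun x _ => t * x) (fun x _ => t⁻¹ * x) ?_ ?_ ?_ ?_ ?_
  · intro x hx; simp_all
  · intro x hx; simp_all
  · intro x hx; simp [ht]
  · intro x hx; simp [ht]
  · intro x hx; congr 1; rw [mul_inv]; ring

theorem sum_sum_kloosterman_pow_four_le (p : ℕ) [Fact p.Prime] :
    ∑ b : ZMod p, ∑ a : ZMod p, ‖kloosterman p a b‖ ^ 4 ≤ (p : ℝ) ^ 2 * (3 * (p - 1) ^ 2) := by
  have h := sum_normSq_eq_card p ((univ.erase (0 : ZMod p)) ×ˢ (univ.erase (0 : ZMod p)))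
    (fun q => q.1 + q.2) (fun q => q.1⁻¹ + q.2⁻¹)
  have hK : ∀ a b : ZMod p, ‖kloosterman p a b‖ ^ 4 =
      ‖∑ i ∈ (univ.erase (0 : ZMod p)) ×ˢ (univ.erase (0 : ZMod p)),
        (ZMod.stdAddChar (a * (i.1 + i.2) + b * (i.1⁻¹ + i.2⁻¹)) : ℂ)‖ ^ 2 := by
    intro a b
    rw [show 4 = 2 * 2 from rfl, pow_mul, ← norm_pow, sq (kloosterman p a b)]
    congr 2
    rw [kloosterman, sum_mul_sum, ← sum_product']
    refine sum_congr rfl fun q _ => ?_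
    rw [← AddChar.map_add_eq_mul]
    congr 1
    ring
  rw [sum_comm]
  simp_rw [hK]
  rw [h]
  have h1 : 1 ≤ p := (Fact.out : p.Prime).one_le
  have h2 : ((3 * (p - 1) ^ 2 : ℕ) : ℝ) = 3 * ((p : ℝ) - 1) ^ 2 := by
    push_cast [h1]; ring
  rw [← h2]
  gcongr
  exact card_add_inv_add_le p

/-- Kloosterman's fourth moment bound. -/
theorem sum_kloosterman_pow_four_le (p : ℕ) [Fact p.Prime] (b : ZMod p) (hb : b ≠ 0) :
    ∑ a : ZMod p, ‖kloosterman p a b‖ ^ 4 ≤ 3 * (p : ℝ) ^ 3 := by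
  have hp : (2 : ℝ) ≤ p := by exact_mod_cast (Fact.out : p.Prime).two_le
  have hinv : ∀ c ∈ univ.erase (0 : ZMod p), ∑ a : ZMod p, ‖kloosterman p a c‖ ^ 4 =
      ∑ a : ZMod p, ‖kloosterman p a b‖ ^ 4 := by
    intro c hc
    have hc0 : c ≠ 0 := by simpa using hc
    have ht : b * c⁻¹ ≠ 0 := mul_ne_zero hb (inv_ne_zero hc0)
    refine (Fintype.sum_equiv (Equiv.mulRight₀ (b * c⁻¹) ht) _ _ fun a => ?_).symm
    rw [← kloosterman_mul_inv p a b _ ht]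
    simp only [Equiv.mulRight₀_apply]
    congr 3
    field_simp
  have h1 : ∑ c ∈ univ.erase (0 : ZMod p), ∑ a : ZMod p, ‖kloosterman p a c‖ ^ 4 ≤
      (p : ℝ) ^ 2 * (3 * (p - 1) ^ 2) :=
    (sum_le_sum_of_subset_of_nonneg (erase_subset _ _) fun _ _ _ => by positivity).trans
      (sum_sum_kloosterman_pow_four_le p)
  rw [sum_congr rfl hinv, sum_const, card_erase_of_mem (mem_univ _), card_univ, ZMod.card,
    nsmul_eq_mul, Nat.cast_pred (Fact.out : p.Prime).pos] at h1
  have h2 : ∑ a : ZMod p, ‖kloosterman p a b‖ ^ 4 ≤ (p : ℝ) ^ 2 * (3 * (p - 1)) := by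
    refine le_of_mul_le_mul_left ?_ (show (0 : ℝ) < p - 1 by linarith)
    linarith
  nlinarith [sq_nonneg (p : ℝ)]

theorem four_mul_natAbs_valMinAbs_div_le (p : ℕ) [Fact p.Prime] (k : ZMod p) :
    4 * (k.valMinAbs.natAbs : ℝ) / p ≤ ‖(ZMod.stdAddChar k : ℂ) - 1‖ := by
  have hp : (0 : ℝ) < p := by exact_mod_cast (Fact.out : p.Prime).pos
  set j := k.valMinAbs with hj
  have hj2 : (j.natAbs : ℝ) ≤ p / 2 := by
    have := ZMod.natAbs_valMinAbs_le k
    have h2 : 2 * j.natAbs ≤ p := by omega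
    have h3 : (2 * j.natAbs : ℝ) ≤ p := by exact_mod_cast h2
    linarith
  have hψ : (ZMod.stdAddChar k : ℂ) = Complex.exp (Complex.I * ((2 * Real.pi * j / p : ℝ) : ℂ)) := by
    rw [← ZMod.coe_valMinAbs k, ZMod.stdAddChar_coe, ← hj]
    congr 1
    push_cast
    ring
  rw [hψ, Complex.norm_exp_I_mul_ofReal_sub_one, norm_mul, Real.norm_eq_abs, Real.norm_eq_abs,
    abs_of_pos (by norm_num : (0 : ℝ) < 2)]
  rw [Nat.cast_natAbs, Int.cast_abs] at hj2 ⊢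
  have habs : |2 * Real.pi * j / p / 2| = Real.pi * |(j : ℝ)| / p := by
    rw [show 2 * Real.pi * j / p / 2 = Real.pi * j / p by ring, abs_div, abs_mul,
      abs_of_pos Real.pi_pos, abs_of_pos hp]
  have h := Real.mul_abs_le_abs_sin (x := 2 * Real.pi * j / p / 2) (by
    rw [habs, div_le_iff₀ hp]
    nlinarith [Real.pi_pos])
  rw [habs] at h
  have h3 : 2 / Real.pi * (Real.pi * |(j : ℝ)| / p) = 2 * |(j : ℝ)| / p := by
    have := Real.pi_ne_zero
    field_simp
  rw [h3] at h
  calc 4 * |(j : ℝ)| / p = 2 * (2 * |(j : ℝ)| / p) := by ring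
    _ ≤ _ := by gcongr

theorem sum_comp_natAbs_valMinAbs_le (p : ℕ) [Fact p.Prime] (f : ℕ → ℝ) (hf : ∀ m, 0 ≤ f m) :
    ∑ k ∈ univ.erase (0 : ZMod p), f k.valMinAbs.natAbs ≤ 2 * ∑ m ∈ Icc 1 (p / 2), f m := by
  have hmaps : ∀ k ∈ univ.erase (0 : ZMod p), k.valMinAbs.natAbs ∈ Icc 1 (p / 2) := by
    intro k hk
    have hk0 : k ≠ 0 := by simpa using hk
    have h1 := ZMod.natAbs_valMinAbs_le k
    have h2 : k.valMinAbs ≠ 0 := fun h => hk0 ((ZMod.valMinAbs_eq_zero k).mp h)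
    rw [mem_Icc]
    omega
  rw [← sum_fiberwise_of_maps_to hmaps, mul_sum]
  refine sum_le_sum fun m _ => ?_
  rw [sum_congr rfl (g := fun _ => f m) (by
    intro k hk
    rw [(mem_filter.mp hk).2]), sum_const, nsmul_eq_mul]
  refine mul_le_mul_of_nonneg_right ?_ (hf m)
  have hsub : {k ∈ univ.erase (0 : ZMod p) | k.valMinAbs.natAbs = m} ⊆
      {(m : ZMod p), -(m : ZMod p)} := by
    intro k hk
    have hk' := (mem_filter.mp hk).2
    rw [mem_insert, mem_singleton]
    have h := ZMod.coe_valMinAbs k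
    rcases Int.natAbs_eq k.valMinAbs with h1 | h1
    · left; rw [← h, h1, hk']; simp
    · right; rw [← h, h1, hk']; simp
  exact_mod_cast (card_le_card hsub).trans card_le_two

theorem sum_rpow_neg_four_thirds_le (n : ℕ) :
    ∑ m ∈ Icc 1 n, (m : ℝ) ^ (-(4 / 3) : ℝ) ≤ 4 := by
  have key : ∀ n : ℕ, ∑ m ∈ Icc 1 (n + 1), (m : ℝ) ^ (-(4 / 3) : ℝ) ≤
      4 - 3 * ((n + 1 : ℕ) : ℝ) ^ (-(1 / 3) : ℝ) := by
    intro n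
    induction n with
    | zero => norm_num
    | succ n ih =>
      rw [sum_Icc_succ_top (by omega)]
      refine (add_le_add_left ih _).trans ?_
      set x : ℝ := ((n + 1 : ℕ) : ℝ) with hx
      have hx0 : 0 < x := by positivity
      have hx1 : ((n + 1 + 1 : ℕ) : ℝ) = x + 1 := by rw [hx]; push_cast; ring
      rw [hx1]
      set u := x ^ (1 / 3 : ℝ) with hu
      set v := (x + 1) ^ (1 / 3 : ℝ) with hv
      have hu0 : 0 < u := by positivity
      have hv0 : 0 < v := by positivity
      have huv : u ≤ v := Real.rpow_le_rpow hx0.le (by linarith) (by norm_num)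
      have hu3 : u ^ 3 = x := by
        rw [hu, ← Real.rpow_mul_natCast hx0.le]; norm_num
      have hv3 : v ^ 3 = x + 1 := by
        rw [hv, ← Real.rpow_mul_natCast (by positivity)]; norm_num
      have e1 : (x + 1) ^ (-(4 / 3) : ℝ) = (v ^ 4)⁻¹ := by
        rw [hv, ← Real.rpow_mul_natCast (by positivity), ← Real.rpow_neg (by positivity)]
        norm_num
      rw [e1, Real.rpow_neg hx0.le, Real.rpow_neg (by positivity), ← hu, ← hv]
      have h1 : 1 = (v - u) * (v ^ 2 + u * v + u ^ 2) := by linear_combination hu3 - hv3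
      have h2 : v ^ 2 + u * v + u ^ 2 ≤ 3 * v ^ 2 := by nlinarith
      have h3 : 1 ≤ (v - u) * (3 * v ^ 2) := by
        have := mul_le_mul_of_nonneg_left h2 (sub_nonneg.mpr huv)
        linarith
      have h4 : u ≤ 3 * (v - u) * v ^ 3 := by
        have := mul_le_mul huv h3 (by norm_num) hv0.le
        nlinarith
      have h5 : (v ^ 4)⁻¹ ≤ 3 * (u⁻¹ - v⁻¹) := by
        have : 3 * (u⁻¹ - v⁻¹) - (v ^ 4)⁻¹ = (3 * (v - u) * v ^ 3 - u) * (u * v ^ 4)⁻¹ := by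
          field_simp
        have : 0 ≤ 3 * (u⁻¹ - v⁻¹) - (v ^ 4)⁻¹ := by
          rw [this]
          exact mul_nonneg (by linarith) (by positivity)
        linarith
      linarith
  rcases n with _ | n
  · norm_num
  · refine (key n).trans ?_
    have : (0 : ℝ) ≤ ((n + 1 : ℕ) : ℝ) ^ (-(1 / 3) : ℝ) := by positivity
    linarith

theorem norm_sum_Ico_stdAddChar_le (p : ℕ) [Fact p.Prime] {A B : ℕ} (hAB : A ≤ B) (a : ZMod p)
    (ha : a ≠ 0) :
    ‖∑ u ∈ Ico A B, (ZMod.stdAddChar (a * (u : ZMod p)) : ℂ)‖ ≤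
      p / (2 * a.valMinAbs.natAbs) := by
  have hp : (0 : ℝ) < p := by exact_mod_cast (Fact.out : p.Prime).pos
  have hd : (0 : ℝ) < a.valMinAbs.natAbs := by
    have h2 : a.valMinAbs ≠ 0 := fun h => ha ((ZMod.valMinAbs_eq_zero a).mp h)
    exact_mod_cast Int.natAbs_pos.mpr h2
  have hne : (ZMod.stdAddChar a : ℂ) ≠ 1 := by
    intro h
    exact ha (ZMod.injective_stdAddChar (by rw [h, AddChar.map_zero_eq_one]))
  have hpow : ∀ u : ℕ, (ZMod.stdAddChar (a * (u : ZMod p)) : ℂ) = ZMod.stdAddChar a ^ u := by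
    intro u
    rw [← AddChar.map_nsmul_eq_pow, nsmul_eq_mul, mul_comm]
  simp_rw [hpow]
  rw [geom_sum_Ico hne hAB, norm_div]
  have h1 : ‖(ZMod.stdAddChar a : ℂ) ^ B - ZMod.stdAddChar a ^ A‖ ≤ 2 := by
    refine (norm_sub_le _ _).trans ?_
    rw [norm_pow, norm_pow, AddChar.norm_apply]
    norm_num
  calc _ ≤ 2 / (4 * (a.valMinAbs.natAbs : ℝ) / p) := by
        gcongr
        exact four_mul_natAbs_valMinAbs_div_le p a
    _ = _ := by field_simp; norm_num

theorem sum_norm_rpow_four_thirds_le (p : ℕ) [Fact p.Prime] {A B : ℕ} (hAB : A ≤ B) (hB : B ≤ p) :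
    ∑ a : ZMod p, ‖∑ u ∈ Ico A B, (ZMod.stdAddChar (a * (u : ZMod p)) : ℂ)‖ ^ (4 / 3 : ℝ) ≤
      (3 * (p : ℝ)) ^ (4 / 3 : ℝ) := by
  have hp : (0 : ℝ) < p := by exact_mod_cast (Fact.out : p.Prime).pos
  rw [← sum_erase_add _ _ (mem_univ (0 : ZMod p))]
  have h0 : ‖∑ u ∈ Ico A B, (ZMod.stdAddChar ((0 : ZMod p) * (u : ZMod p)) : ℂ)‖ ^ (4 / 3 : ℝ) ≤
      (p : ℝ) ^ (4 / 3 : ℝ) := by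
    gcongr
    simp only [zero_mul, AddChar.map_zero_eq_one, sum_const, Nat.card_Ico, nsmul_eq_mul, mul_one]
    rw [Complex.norm_natCast]
    exact_mod_cast (by omega : B - A ≤ p)
  have h1 : ∑ a ∈ univ.erase (0 : ZMod p),
      ‖∑ u ∈ Ico A B, (ZMod.stdAddChar (a * (u : ZMod p)) : ℂ)‖ ^ (4 / 3 : ℝ) ≤
      ∑ a ∈ univ.erase (0 : ZMod p),
        (p / 2 : ℝ) ^ (4 / 3 : ℝ) * (a.valMinAbs.natAbs : ℝ) ^ (-(4 / 3) : ℝ) := by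
    refine sum_le_sum fun a ha => ?_
    have ha0 : a ≠ 0 := by simpa using ha
    rw [Real.rpow_neg (by positivity), ← div_eq_mul_inv, ← Real.div_rpow (by positivity)
      (by positivity)]
    gcongr
    refine (norm_sum_Ico_stdAddChar_le p hAB a ha0).trans_eq ?_
    rw [div_div]
  have h2 := sum_comp_natAbs_valMinAbs_le p
    (fun m => (p / 2 : ℝ) ^ (4 / 3 : ℝ) * (m : ℝ) ^ (-(4 / 3) : ℝ)) (fun m => by positivity)
  have h3 := mul_le_mul_of_nonneg_left (sum_rpow_neg_four_thirds_le (p / 2))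
    (by positivity : (0 : ℝ) ≤ (p / 2 : ℝ) ^ (4 / 3 : ℝ))
  have h4 : (p / 2 : ℝ) ^ (4 / 3 : ℝ) = (p : ℝ) ^ (4 / 3 : ℝ) / 2 ^ (4 / 3 : ℝ) :=
    Real.div_rpow hp.le (by norm_num) _
  have h5 : (3 * (p : ℝ)) ^ (4 / 3 : ℝ) = 3 ^ (4 / 3 : ℝ) * (p : ℝ) ^ (4 / 3 : ℝ) :=
    Real.mul_rpow (by norm_num) hp.le
  have e2 : (5 / 2 : ℝ) ≤ 2 ^ (4 / 3 : ℝ) := by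
    refine le_of_pow_le_pow_left₀ (n := 3) (by norm_num) (by positivity) ?_
    rw [← Real.rpow_mul_natCast (by norm_num)]
    norm_num
  have e3 : (21 / 5 : ℝ) ≤ 3 ^ (4 / 3 : ℝ) := by
    refine le_of_pow_le_pow_left₀ (n := 3) (by norm_num) (by positivity) ?_
    rw [← Real.rpow_mul_natCast (by norm_num)]
    norm_num
  have hP : 0 ≤ (p : ℝ) ^ (4 / 3 : ℝ) := by positivity
  have h6 : (p : ℝ) ^ (4 / 3 : ℝ) / 2 ^ (4 / 3 : ℝ) ≤ (p : ℝ) ^ (4 / 3 : ℝ) / (5 / 2) := by gcongr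
  simp only [← mul_sum] at h1 h2
  rw [h4] at h1 h2 h3
  rw [h5]
  nlinarith

/-- An incomplete Kloosterman sum over an interval is `O(p^{3/4})`, without a logarithm: complete
the sum and apply Hölder's inequality with exponents `4/3` and `4`. -/
theorem norm_incomplete_kloosterman_le (p : ℕ) [Fact p.Prime] {A B : ℕ} (hA : 1 ≤ A) (hAB : A ≤ B)
    (hB : B ≤ p) (b c : ZMod p) (hb : b ≠ 0) :
    ‖∑ u ∈ Ico A B, (ZMod.stdAddChar (c * (u : ZMod p) + b * (u : ZMod p)⁻¹) : ℂ)‖ ≤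
      4 * (p : ℝ) ^ (3 / 4 : ℝ) := by
  have hp : (0 : ℝ) < p := by exact_mod_cast (Fact.out : p.Prime).pos
  set G : ZMod p → ℂ := fun a => ∑ u ∈ Ico A B, (ZMod.stdAddChar (a * (u : ZMod p)) : ℂ) with hG
  have hcomp : (p : ℂ) * ∑ u ∈ Ico A B,
      (ZMod.stdAddChar (c * (u : ZMod p) + b * (u : ZMod p)⁻¹) : ℂ) =
      ∑ a : ZMod p, G a * kloosterman p (c - a) b := by
    simp only [hG, kloosterman, sum_mul_sum]
    rw [sum_comm, mul_sum]
    refine sum_congr rfl fun u hu => ?_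
    rw [sum_comm]
    have hu0 : (u : ZMod p) ≠ 0 := by
      rw [mem_Ico] at hu
      intro h
      have := Nat.le_of_dvd (by omega) ((ZMod.natCast_eq_zero_iff u p).mp h)
      omega
    have hx : ∀ x ∈ univ.erase (0 : ZMod p),
        ∑ a : ZMod p, (ZMod.stdAddChar (a * (u : ZMod p)) : ℂ) *
          ZMod.stdAddChar ((c - a) * x + b * x⁻¹) =
        if x = u then (p : ℂ) * ZMod.stdAddChar (c * x + b * x⁻¹) else 0 := by
      intro x _
      have : ∀ a : ZMod p, (ZMod.stdAddChar (a * (u : ZMod p)) : ℂ) *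
          ZMod.stdAddChar ((c - a) * x + b * x⁻¹) =
          ZMod.stdAddChar (a * ((u : ZMod p) - x)) * ZMod.stdAddChar (c * x + b * x⁻¹) := by
        intro a
        rw [← AddChar.map_add_eq_mul, ← AddChar.map_add_eq_mul]
        congr 1
        ring
      simp_rw [this]
      rw [← sum_mul, sum_stdAddChar_mul, ite_mul, zero_mul]
      refine if_congr ?_ rfl rfl
      rw [sub_eq_zero, eq_comm]
    rw [sum_congr rfl hx, sum_ite_eq', if_pos (by simpa using hu0)]
  have hconj : Real.HolderConjugate (4 / 3) 4 := by
    rw [Real.holderConjugate_iff]; norm_num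
  have hH := Real.inner_le_Lp_mul_Lq_of_nonneg univ (f := fun a => ‖G a‖)
    (g := fun a => ‖kloosterman p (c - a) b‖) hconj (fun _ _ => norm_nonneg _)
    (fun _ _ => norm_nonneg _)
  have h1 : (∑ a : ZMod p, ‖G a‖ ^ (4 / 3 : ℝ)) ^ (1 / (4 / 3) : ℝ) ≤ 3 * p := by
    calc _ ≤ ((3 * (p : ℝ)) ^ (4 / 3 : ℝ)) ^ (1 / (4 / 3) : ℝ) := by
          gcongr
          exact sum_norm_rpow_four_thirds_le p hAB hB
      _ = 3 * p := by
          rw [← Real.rpow_mul (by positivity)]; norm_num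
  have h2 : (∑ a : ZMod p, ‖kloosterman p (c - a) b‖ ^ (4 : ℝ)) ^ (1 / 4 : ℝ) ≤
      4 / 3 * (p : ℝ) ^ (3 / 4 : ℝ) := by
    have e : ∑ a : ZMod p, ‖kloosterman p (c - a) b‖ ^ (4 : ℝ) =
        ∑ a : ZMod p, ‖kloosterman p a b‖ ^ 4 :=
      Fintype.sum_equiv (Equiv.subLeft c) _ _ fun a => by
        rw [Equiv.subLeft_apply]; exact_mod_cast rfl
    rw [e]
    calc _ ≤ (3 * (p : ℝ) ^ 3) ^ (1 / 4 : ℝ) := by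
          gcongr
          exact sum_kloosterman_pow_four_le p b hb
      _ ≤ ((4 / 3 : ℝ) ^ 4 * (p : ℝ) ^ 3) ^ (1 / 4 : ℝ) := by
          gcongr
          norm_num
      _ = _ := by
          rw [Real.mul_rpow (by positivity) (by positivity), ← Real.rpow_natCast_mul (by norm_num),
            ← Real.rpow_natCast_mul hp.le]
          norm_num
  have h3 : (p : ℝ) * ‖∑ u ∈ Ico A B,
      (ZMod.stdAddChar (c * (u : ZMod p) + b * (u : ZMod p)⁻¹) : ℂ)‖ ≤
      (3 * p) * (4 / 3 * (p : ℝ) ^ (3 / 4 : ℝ)) := by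
    calc _ = ‖∑ a : ZMod p, G a * kloosterman p (c - a) b‖ := by
          rw [← hcomp, norm_mul, Complex.norm_natCast]
      _ ≤ ∑ a : ZMod p, ‖G a‖ * ‖kloosterman p (c - a) b‖ := by
          refine (norm_sum_le _ _).trans_eq (sum_congr rfl fun a _ => norm_mul _ _)
      _ ≤ _ := hH.trans (mul_le_mul h1 h2 (by positivity) (by positivity))
  refine le_of_mul_le_mul_left ?_ hp
  linarith

theorem norm_sum_stdAddChar_mul_val_le (p : ℕ) [Fact p.Prime] (k : ZMod p) (hk : k ≠ 0) :
    ‖∑ j : ZMod p, (ZMod.stdAddChar (-(j * k)) : ℂ) * (j.val : ℂ)‖ ≤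
      (p : ℝ) ^ 2 / (4 * k.valMinAbs.natAbs) := by
  have hp : (0 : ℝ) < p := by exact_mod_cast (Fact.out : p.Prime).pos
  have hd : (0 : ℝ) < k.valMinAbs.natAbs := by
    have h2 : k.valMinAbs ≠ 0 := fun h => hk ((ZMod.valMinAbs_eq_zero k).mp h)
    exact_mod_cast Int.natAbs_pos.mpr h2
  have hval : ∀ j : ZMod p, (j.val : ℂ) - ((j - 1).val : ℂ) = 1 - if j = 0 then (p : ℂ) else 0 := by
    intro j
    have h1 : (1 : ZMod p).val = 1 := ZMod.val_one p
    split_ifs with hj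
    · rw [hj, zero_sub, ZMod.neg_val, if_neg one_ne_zero, h1, ZMod.val_zero,
        Nat.cast_pred (Fact.out : p.Prime).pos]
      push_cast
      ring
    · have h0 : 1 ≤ j.val := Nat.one_le_iff_ne_zero.mpr (by rwa [ne_eq, ZMod.val_eq_zero])
      rw [ZMod.val_sub (by rw [h1]; exact h0), h1, Nat.cast_pred h0]
      ring
  have hshift : (ZMod.stdAddChar (-k) : ℂ) *
      ∑ j : ZMod p, (ZMod.stdAddChar (-(j * k)) : ℂ) * (j.val : ℂ) =
      ∑ j : ZMod p, (ZMod.stdAddChar (-(j * k)) : ℂ) * ((j - 1).val : ℂ) := by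
    rw [mul_sum]
    refine Fintype.sum_equiv (Equiv.addRight 1) _ _ fun j => ?_
    rw [Equiv.coe_addRight, add_sub_cancel_right, ← mul_assoc, ← AddChar.map_add_eq_mul]
    congr 2
    ring
  have hsum : ∑ j : ZMod p, (ZMod.stdAddChar (-(j * k)) : ℂ) = 0 := by
    have := sum_stdAddChar_mul p (-k)
    rw [if_neg (neg_ne_zero.mpr hk)] at this
    simpa only [mul_neg] using this
  have hmain : ((ZMod.stdAddChar (-k) : ℂ) - 1) *
      ∑ j : ZMod p, (ZMod.stdAddChar (-(j * k)) : ℂ) * (j.val : ℂ) = p := by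
    rw [sub_mul, one_mul, hshift, ← neg_sub, ← sum_sub_distrib]
    simp_rw [← mul_sub, hval, mul_sub, mul_one]
    rw [sum_sub_distrib, hsum]
    simp
  have hnorm := congrArg norm hmain
  rw [norm_mul, Complex.norm_natCast] at hnorm
  have h4 := four_mul_natAbs_valMinAbs_div_le p (-k)
  rw [ZMod.natAbs_valMinAbs_neg] at h4
  rw [le_div_iff₀ (by positivity)]
  have h5 := mul_le_mul_of_nonneg_right h4
    (norm_nonneg (∑ j : ZMod p, (ZMod.stdAddChar (-(j * k)) : ℂ) * (j.val : ℂ)))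
  rw [hnorm, div_mul_eq_mul_div, div_le_iff₀ hp] at h5
  linarith

theorem sum_val_sub_mean (p : ℕ) [Fact p.Prime] (n : ZMod p) :
    (p : ℂ) * (n.val : ℂ) - ∑ j : ZMod p, (j.val : ℂ) =
      ∑ k ∈ univ.erase (0 : ZMod p),
        (∑ j : ZMod p, (ZMod.stdAddChar (-(j * k)) : ℂ) * (j.val : ℂ)) *
          ZMod.stdAddChar (k * n) := by
  have h : ∑ k : ZMod p, (∑ j : ZMod p, (ZMod.stdAddChar (-(j * k)) : ℂ) * (j.val : ℂ)) *
      ZMod.stdAddChar (k * n) = (p : ℂ) * (n.val : ℂ) := by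
    simp_rw [sum_mul]
    rw [sum_comm]
    have : ∀ j k : ZMod p, (ZMod.stdAddChar (-(j * k)) : ℂ) * (j.val : ℂ) *
        ZMod.stdAddChar (k * n) = ZMod.stdAddChar (k * (n - j)) * (j.val : ℂ) := by
      intro j k
      rw [mul_right_comm, ← AddChar.map_add_eq_mul]
      congr 2
      ring
    simp_rw [this, ← sum_mul, sum_stdAddChar_mul, sub_eq_zero, ite_mul, zero_mul]
    rw [sum_ite_eq, if_pos (mem_univ n)]
  rw [← h, ← sum_erase_add _ _ (mem_univ (0 : ZMod p))]
  simp

/-- Equidistribution modulo `p` of `x⁻¹` relative to a line, measured by the sawtooth function. -/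
theorem abs_sum_val_sub_mean_le (p : ℕ) [Fact p.Prime] {A B : ℕ} (hA : 1 ≤ A) (hAB : A ≤ B)
    (hB : B ≤ p) (α γ : ZMod p) :
    |∑ x ∈ Ico A B, ((((x : ZMod p)⁻¹ - (α * x + γ)).val : ℝ) - (∑ j : ZMod p, (j.val : ℝ)) / p)| ≤
      2 * p * (p : ℝ) ^ (3 / 4 : ℝ) * (1 + Real.log (p / 2 : ℕ)) := by
  have hp : (0 : ℝ) < p := by exact_mod_cast (Fact.out : p.Prime).pos
  set D : ZMod p → ℂ := fun k => ∑ j : ZMod p, (ZMod.stdAddChar (-(j * k)) : ℂ) * (j.val : ℂ) with hD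
  have hexp : (((p : ℝ) * ∑ x ∈ Ico A B, ((((x : ZMod p)⁻¹ - (α * x + γ)).val : ℝ) -
      (∑ j : ZMod p, (j.val : ℝ)) / p) : ℝ) : ℂ) =
      ∑ k ∈ univ.erase (0 : ZMod p), D k * ZMod.stdAddChar (-(k * γ)) *
        ∑ x ∈ Ico A B, (ZMod.stdAddChar (-(k * α) * (x : ZMod p) + k * (x : ZMod p)⁻¹) : ℂ) := by
    simp_rw [mul_sum]
    rw [sum_comm]
    push_cast
    refine sum_congr rfl fun x _ => ?_
    have hp' : (p : ℂ) ≠ 0 := by exact_mod_cast hp.ne'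
    rw [mul_sub, mul_div_cancel₀ _ hp', sum_val_sub_mean]
    refine sum_congr rfl fun k _ => ?_
    rw [mul_assoc, ← AddChar.map_add_eq_mul]
    congr 2
    ring
  have hbound : ‖(((p : ℝ) * ∑ x ∈ Ico A B, ((((x : ZMod p)⁻¹ - (α * x + γ)).val : ℝ) -
      (∑ j : ZMod p, (j.val : ℝ)) / p) : ℝ) : ℂ)‖ ≤
      ∑ k ∈ univ.erase (0 : ZMod p),
        (p : ℝ) ^ 2 * (p : ℝ) ^ (3 / 4 : ℝ) * ((k.valMinAbs.natAbs : ℝ))⁻¹ := by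
    rw [hexp]
    refine (norm_sum_le _ _).trans (sum_le_sum fun k hk => ?_)
    have hk0 : k ≠ 0 := by simpa using hk
    rw [norm_mul, norm_mul, AddChar.norm_apply, mul_one]
    calc _ ≤ (p : ℝ) ^ 2 / (4 * k.valMinAbs.natAbs) * (4 * (p : ℝ) ^ (3 / 4 : ℝ)) := by
          gcongr
          · exact norm_sum_stdAddChar_mul_val_le p k hk0
          · exact norm_incomplete_kloosterman_le p hA hAB hB k _ hk0
      _ = _ := by
          rw [mul_comm 4 (k.valMinAbs.natAbs : ℝ), ← div_div]
          ring
  have hsum := sum_comp_natAbs_valMinAbs_le p (fun m => (m : ℝ)⁻¹) (fun m => by positivity)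
  have hharm : ∑ m ∈ Icc 1 (p / 2), (m : ℝ)⁻¹ ≤ 1 + Real.log (p / 2 : ℕ) := by
    have := harmonic_le_one_add_log (p / 2)
    simpa only [harmonic_eq_sum_Icc, Rat.cast_sum, Rat.cast_inv, Rat.cast_natCast] using this
  rw [← mul_sum, Complex.norm_real, Real.norm_eq_abs, abs_mul, abs_of_pos hp] at hbound
  refine le_of_mul_le_mul_left (hbound.trans ?_) hp
  calc _ ≤ (p : ℝ) ^ 2 * (p : ℝ) ^ (3 / 4 : ℝ) * (2 * (1 + Real.log (p / 2 : ℕ))) := by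
        gcongr
        exact hsum.trans (by gcongr)
    _ = _ := by ring

theorem val_sub_natCast (p : ℕ) [Fact p.Prime] (y : ZMod p) {n : ℕ} (hn : n ≤ p) :
    ((y - n).val : ℝ) = y.val - n + if y.val < n then (p : ℝ) else 0 := by
  have hy := ZMod.val_lt y
  split_ifs with h
  · have e : y - n = ((y.val + p - n : ℕ) : ZMod p) := by
      rw [Nat.cast_sub (by omega), Nat.cast_add, ZMod.natCast_zmod_val, ZMod.natCast_self, add_zero]
    rw [e, ZMod.val_natCast_of_lt (by omega), Nat.cast_sub (by omega)]
    push_cast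
    ring
  · have e : y - n = ((y.val - n : ℕ) : ZMod p) := by
      rw [Nat.cast_sub (by omega), ZMod.natCast_zmod_val]
    rw [e, ZMod.val_natCast_of_lt (by omega), Nat.cast_sub (by omega)]
    ring

/-- Equidistribution of the points `(x, x⁻¹)` in a region between two lines modulo `p`. -/
theorem abs_card_strip_sub_le (p : ℕ) [Fact p.Prime] {A B : ℕ} (hA : 1 ≤ A) (hAB : A ≤ B)
    (hB : B ≤ p) (lo hi : ℕ → ℕ) (α γ α' γ' : ZMod p)
    (hle : ∀ x ∈ Ico A B, lo x ≤ hi x ∧ hi x ≤ p)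
    (hlo : ∀ x ∈ Ico A B, (lo x : ZMod p) = α * x + γ)
    (hhi : ∀ x ∈ Ico A B, (hi x : ZMod p) = α' * x + γ') :
    |(p : ℝ) * #{x ∈ Ico A B | lo x ≤ modInv p x ∧ modInv p x < hi x} -
        ∑ x ∈ Ico A B, ((hi x : ℝ) - lo x)| ≤
      4 * p * (p : ℝ) ^ (3 / 4 : ℝ) * (1 + Real.log (p / 2 : ℕ)) := by
  have h1 := abs_sum_val_sub_mean_le p hA hAB hB α γ
  have h2 := abs_sum_val_sub_mean_le p hA hAB hB α' γ'
  have key : (p : ℝ) * #{x ∈ Ico A B | lo x ≤ modInv p x ∧ modInv p x < hi x} -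
        ∑ x ∈ Ico A B, ((hi x : ℝ) - lo x) =
      ∑ x ∈ Ico A B, ((((x : ZMod p)⁻¹ - (α' * x + γ')).val : ℝ) -
        (∑ j : ZMod p, (j.val : ℝ)) / p) -
      ∑ x ∈ Ico A B, ((((x : ZMod p)⁻¹ - (α * x + γ)).val : ℝ) -
        (∑ j : ZMod p, (j.val : ℝ)) / p) := by
    rw [card_filter, Nat.cast_sum, mul_sum, ← sum_sub_distrib, ← sum_sub_distrib]
    refine sum_congr rfl fun x hx => ?_
    obtain ⟨hlh, hhp⟩ := hle x hx
    rw [← hlo x hx, ← hhi x hx, val_sub_natCast p _ hhp, val_sub_natCast p _ (hlh.trans hhp)]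
    unfold modInv
    split_ifs <;> first | omega | (push_cast; ring)
  rw [key]
  refine (abs_sub _ _).trans ?_
  linarith

theorem modInv_modInv (p : ℕ) [Fact p.Prime] {b : ℕ} (hb : b < p) : modInv p (modInv p b) = b := by
  unfold modInv
  rw [ZMod.natCast_zmod_val, inv_inv, ZMod.val_natCast_of_lt hb]

theorem one_le_modInv (p : ℕ) [Fact p.Prime] {b : ℕ} (h1 : 1 ≤ b) (hb : b < p) :
    1 ≤ modInv p b := by
  unfold modInv
  rw [Nat.one_le_iff_ne_zero, ne_eq, ZMod.val_eq_zero, inv_eq_zero, ZMod.natCast_eq_zero_iff]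
  exact fun h => absurd (Nat.le_of_dvd h1 h) (by omega)

theorem card_Bplus (p : ℕ) (hp : 2 ≤ p) :
    #(Bplus p) = #{x ∈ Ico ((p + 1) / 3) ((p - 1) / 2) |
      p - x ≤ modInv p x ∧ modInv p x < 2 * x + 1} := by
  congr 1
  ext x
  simp only [Bplus, mem_filter, mem_Icc, mem_Ico]
  omega

theorem card_Bminus (p : ℕ) [Fact p.Prime] (h2 : p ≠ 2) :
    #(Bminus p) =
      #{y ∈ Ico ((p + 2) / 4) ((p + 1) / 3) | p - 1 - 2 * y ≤ modInv p y ∧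
        modInv p y < (p - 1) / 2} +
      #{y ∈ Ico ((p + 1) / 3) ((p - 1) / 2) | y + 1 ≤ modInv p y ∧
        modInv p y < (p - 1) / 2} := by
  have hp : 2 ≤ p := (Fact.out : p.Prime).two_le
  have hodd : p % 2 = 1 := (Fact.out : p.Prime).eq_two_or_odd.resolve_left h2
  rw [← card_union_of_disjoint]
  · refine card_nbij' (modInv p) (modInv p) ?_ ?_ ?_ ?_
    · intro β hβ
      simp only [Bminus, coe_filter, Set.mem_ofPred_eq, mem_Icc] at hβ
      have h3 := modInv_modInv p (b := β) (by omega)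
      have h4 := one_le_modInv p (b := β) (by omega) (by omega)
      simp only [coe_union, coe_filter, Set.mem_union, Set.mem_ofPred_eq, mem_Ico, h3]
      omega
    · intro y hy
      simp only [coe_union, coe_filter, Set.mem_union, Set.mem_ofPred_eq, mem_Ico] at hy
      have h3 := modInv_modInv p (b := y) (by omega)
      have h4 := one_le_modInv p (b := y) (by omega) (by omega)
      simp only [Bminus, coe_filter, Set.mem_ofPred_eq, mem_Icc, h3]
      omega
    · intro β hβ
      simp only [Bminus, coe_filter, Set.mem_ofPred_eq, mem_Icc] at hβ
      exact modInv_modInv p (by omega)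
    · intro y hy
      simp only [coe_union, coe_filter, Set.mem_union, Set.mem_ofPred_eq, mem_Ico] at hy
      exact modInv_modInv p (by omega)
  · rw [disjoint_left]
    intro y hy hy'
    simp only [mem_filter, mem_Ico] at hy hy'
    omega

theorem card_Bset (p : ℕ) : #(Bset p) = #(Bminus p) + #(Bplus p) := by
  rw [Bset, card_union_of_disjoint]
  rw [disjoint_left]
  intro β h h'
  simp only [Bminus, Bplus, mem_filter, mem_Icc] at h h'
  omega

theorem sum_Ico_two_mul_sub (c : ℝ) {a b : ℕ} (hab : a ≤ b) :
    ∑ x ∈ Ico a b, (2 * (x : ℝ) - c) =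
      (b : ℝ) * (b - 1) - (a : ℝ) * (a - 1) - c * ((b : ℝ) - a) := by
  induction b, hab using Nat.le_induction with
  | base => simp
  | succ b hab ih =>
    rw [sum_Ico_succ_top hab, ih]
    push_cast
    ring

theorem abs_main_term_sub_le (m : ℕ) (hm : 1 ≤ m) :
    |∑ y ∈ Ico ((2 * m + 3) / 4) ((2 * m + 2) / 3), ((m : ℝ) - ((2 * m - 2 * y : ℕ) : ℝ)) +
      ∑ y ∈ Ico ((2 * m + 2) / 3) m, ((m : ℝ) - ((y + 1 : ℕ) : ℝ)) +
      ∑ x ∈ Ico ((2 * m + 2) / 3) m, (((2 * x + 1 : ℕ) : ℝ) - ((2 * m + 1 - x : ℕ) : ℝ)) -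
      (2 * (m : ℝ) + 1) ^ 2 / 16| ≤ 2 * (m : ℝ) + 1 := by
  set q := (2 * m + 3) / 4 with hq
  set r := (2 * m + 2) / 3 with hr
  have hqr : q ≤ r := by omega
  have hrm : r ≤ m := by omega
  have e1 : ∑ y ∈ Ico q r, ((m : ℝ) - ((2 * m - 2 * y : ℕ) : ℝ)) =
      ∑ y ∈ Ico q r, (2 * (y : ℝ) - m) := by
    refine sum_congr rfl fun y hy => ?_
    rw [mem_Ico] at hy
    rw [Nat.cast_sub (by omega)]
    push_cast
    ring
  have e2 : ∑ y ∈ Ico r m, ((m : ℝ) - ((y + 1 : ℕ) : ℝ)) +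
      ∑ x ∈ Ico r m, (((2 * x + 1 : ℕ) : ℝ) - ((2 * m + 1 - x : ℕ) : ℝ)) =
      ∑ x ∈ Ico r m, (2 * (x : ℝ) - (m + 1)) := by
    rw [← sum_add_distrib]
    refine sum_congr rfl fun y hy => ?_
    rw [mem_Ico] at hy
    rw [Nat.cast_sub (by omega)]
    push_cast
    ring
  rw [add_assoc, e1, e2, sum_Ico_two_mul_sub _ hqr, sum_Ico_two_mul_sub _ hrm]
  have b1 : (2 * m : ℝ) ≤ 4 * q := by exact_mod_cast (by omega : 2 * m ≤ 4 * q)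
  have b2 : (4 * q : ℝ) ≤ 2 * m + 3 := by exact_mod_cast (by omega : 4 * q ≤ 2 * m + 3)
  have b3 : (3 * r : ℝ) ≤ 2 * m + 2 := by exact_mod_cast (by omega : 3 * r ≤ 2 * m + 2)
  have b4 : (2 * m : ℝ) ≤ 3 * r := by exact_mod_cast (by omega : 2 * m ≤ 3 * r)
  have hm' : (1 : ℝ) ≤ m := by exact_mod_cast hm
  rw [abs_le]
  have b5 : 0 ≤ (4 * (q : ℝ) - 2 * m) * (2 * m + 3 - 4 * q) :=
    mul_nonneg (by linarith) (by linarith)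
  constructor <;> nlinarith [sq_nonneg (4 * (q : ℝ) - 2 * m)]

theorem abs_card_Bset_sub_le (p : ℕ) [Fact p.Prime] (h2 : p ≠ 2) :
    |((Bset p).card : ℝ) - (p : ℝ) / 16| ≤
      12 * (p : ℝ) ^ ((3 : ℝ) / 4) * (1 + Real.log (p / 2 : ℕ)) + 1 := by
  have hp : 2 ≤ p := (Fact.out : p.Prime).two_le
  have hodd : p % 2 = 1 := (Fact.out : p.Prime).eq_two_or_odd.resolve_left h2
  have hp0 : (0 : ℝ) < p := by positivity
  obtain ⟨m, hm⟩ : ∃ m, p = 2 * m + 1 := ⟨p / 2, by omega⟩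
  have s1 := abs_card_strip_sub_le p (A := (p + 2) / 4) (B := (p + 1) / 3) (by omega) (by omega)
    (by omega) (fun y => p - 1 - 2 * y) (fun _ => (p - 1) / 2) (-2) (-1) 0 (((p - 1) / 2 : ℕ))
    (fun y hy => by rw [mem_Ico] at hy; omega)
    (fun y hy => by
      rw [mem_Ico] at hy
      rw [Nat.cast_sub (by omega), Nat.cast_sub (by omega), ZMod.natCast_self]
      push_cast
      ring)
    (fun y _ => by ring)
  have s2 := abs_card_strip_sub_le p (A := (p + 1) / 3) (B := (p - 1) / 2) (by omega) (by omega)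
    (by omega) (fun y => y + 1) (fun _ => (p - 1) / 2) 1 1 0 (((p - 1) / 2 : ℕ))
    (fun y hy => by rw [mem_Ico] at hy; omega)
    (fun y _ => by push_cast; ring)
    (fun y _ => by ring)
  have s3 := abs_card_strip_sub_le p (A := (p + 1) / 3) (B := (p - 1) / 2) (by omega) (by omega)
    (by omega) (fun x => p - x) (fun x => 2 * x + 1) (-1) 0 2 1
    (fun y hy => by rw [mem_Ico] at hy; omega)
    (fun y hy => by
      rw [mem_Ico] at hy
      rw [Nat.cast_sub (by omega), ZMod.natCast_self]
      ring)
    (fun y _ => by push_cast; ring)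
  have hM := abs_main_term_sub_le m (by omega)
  have i1 : (p + 2) / 4 = (2 * m + 3) / 4 := by omega
  have i2 : (p + 1) / 3 = (2 * m + 2) / 3 := by omega
  have i3 : p - 1 = 2 * m := by omega
  have i4 : 2 * m / 2 = m := by omega
  have hpm : (p : ℝ) = 2 * m + 1 := by rw [hm]; push_cast; ring
  have hcard : ((Bset p).card : ℝ) = _ :=
    congrArg _ ((card_Bset p).trans (congrArg₂ _ (card_Bminus p h2) (card_Bplus p hp)))
  rw [← hm, ← hpm] at hM
  simp only [i1, i2, i3, i4] at s1 s2 s3 hcard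
  push_cast only [Nat.cast_add] at hcard
  rw [hcard]
  refine le_of_mul_le_mul_left ?_ hp0
  rw [← abs_of_pos hp0, ← abs_mul, abs_of_pos hp0]
  rw [abs_le] at s1 s2 s3 hM ⊢
  constructor <;> linarith

theorem stmt_8 (p : ℕ) (hp : p.Prime) :
    |((Bset p).card : ℝ) - (p : ℝ) / 16| ≤ 24 * (p : ℝ) ^ ((3 : ℝ) / 4) * Real.log p := by
  have : Fact p.Prime := ⟨hp⟩
  have hp1 : (1 : ℝ) ≤ p := by exact_mod_cast hp.one_le
  have hP : 1 ≤ (p : ℝ) ^ ((3 : ℝ) / 4) := Real.one_le_rpow hp1 (by norm_num)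
  have hl2 := Real.log_two_gt_d9
  by_cases h2 : p = 2
  · subst h2
    have : Bset 2 = ∅ := by
      ext x
      simp only [Bset, Bminus, Bplus, mem_union, mem_filter, mem_Icc, notMem_empty, iff_false]
      omega
    rw [this, card_empty]
    have : (1 : ℝ) / 2 ≤ ((2 : ℕ) : ℝ) ^ ((3 : ℝ) / 4) * Real.log (2 : ℕ) := by
      push_cast at hP ⊢
      nlinarith
    rw [abs_le]
    push_cast at this ⊢
    constructor <;> linarith
  · have h3 : 3 ≤ p := by have := hp.two_le; omega
    have hlog3 : 1 ≤ Real.log p := by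
      rw [Real.le_log_iff_exp_le (by linarith)]
      have := Real.exp_one_lt_d9
      have : (3 : ℝ) ≤ p := by exact_mod_cast h3
      linarith
    have hlog : Real.log (p / 2 : ℕ) ≤ Real.log p - Real.log 2 := by
      rw [← Real.log_div (by positivity) (by norm_num)]
      refine Real.log_le_log ?_ Nat.cast_div_le
      exact_mod_cast (by omega : 0 < p / 2)
    refine (abs_card_Bset_sub_le p h2).trans ?_
    nlinarith
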